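/- Let X be a complete metric space without isolated points. Then the set of Cantor sets in X (non-empty compact, perfect, totally disconnected subsets) is a dense G_δ subset of the hyperspace K(X) of non-empty compact subsets of X endowed with the Hausdorff metric. -/

import Mathlib

open TopologicalSpace

/-- Compact sets split by finitely many disjoint open sets of small diameter, each of which
meets the compact set in at least two points. -/
def cantorApprox (X : Type*) [MetricSpace X] (ε : ℝ) : Set (NonemptyCompacts X) :=
  {K | ∃ (n : ℕ) (U : Fin n → Set X), (∀ i, IsOpen (U i)) ∧ (∀ i j, i ≠ j → Disjoint (U i) (U j)) ∧
    (∀ i, ∀ x ∈ U i, ∀ y ∈ U i, dist x y < ε) ∧ (K : Set X) ⊆ ⋃ i, U i ∧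
    ∀ i, ((K : Set X) ∩ U i).Nontrivial}

lemma isOpen_nontrivial_inter {X : Type*} [MetricSpace X] {U : Set X} (hU : IsOpen U) :
    IsOpen {K : NonemptyCompacts X | ((K : Set X) ∩ U).Nontrivial} := by
  rw [isOpen_iff_forall_mem_open]
  rintro K ⟨x, ⟨hxK, hxU⟩, y, ⟨hyK, hyU⟩, hxy⟩
  obtain ⟨V, W, hV, hW, hxV, hyW, hVW⟩ := t2_separation hxy
  refine ⟨{K | ((K : Set X) ∩ (U ∩ V)).Nonempty} ∩ {K | ((K : Set X) ∩ (U ∩ W)).Nonempty}, ?_,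
    (NonemptyCompacts.isOpen_inter_nonempty_of_isOpen (hU.inter hV)).inter
    (NonemptyCompacts.isOpen_inter_nonempty_of_isOpen (hU.inter hW)),
    ⟨x, hxK, hxU, hxV⟩, ⟨y, hyK, hyU, hyW⟩⟩
  rintro L ⟨⟨a, haL, haU, haV⟩, ⟨b, hbL, hbU, hbW⟩⟩
  exact ⟨a, ⟨haL, haU⟩, b, ⟨hbL, hbU⟩, hVW.ne_of_mem haV hbW⟩

lemma isOpen_cantorApprox (X : Type*) [MetricSpace X] (ε : ℝ) : IsOpen (cantorApprox X ε) := by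
  rw [isOpen_iff_forall_mem_open]
  rintro K ⟨n, U, hU, hd, hε, hK, hn⟩
  refine ⟨{K | (K : Set X) ⊆ ⋃ i, U i} ∩ ⋂ i, {K | ((K : Set X) ∩ U i).Nontrivial}, ?_,
    (NonemptyCompacts.isOpen_subsets_of_isOpen (isOpen_iUnion hU)).inter
    (isOpen_iInter_of_finite fun i => isOpen_nontrivial_inter (hU i)), hK, Set.mem_iInter.2 hn⟩
  rintro L ⟨h1, h2⟩
  exact ⟨n, U, hU, hd, hε, h1, Set.mem_iInter.1 h2⟩

lemma dense_cantorApprox (X : Type*) [MetricSpace X]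
    (hX : ∀ x : X, Filter.NeBot (nhdsWithin x {x}ᶜ)) {ε : ℝ} (hε : 0 < ε) :
    Dense (cantorApprox X ε) := by
  rw [dense_iff_inter_open]
  intro O hO hne
  obtain ⟨F, hFO, hF⟩ := NonemptyCompacts.dense_setOfPred_finite.inter_open_nonempty O hO hne
  change (F : Set X).Finite at hF
  obtain ⟨η, hη, hb⟩ := Metric.isOpen_iff.1 hO F hFO
  obtain ⟨V, hV, hVd⟩ := hF.t2_separation
  let U : X → Set X := fun x => V x ∩ Metric.ball x (min (ε / 2) (η / 2))
  have hr : 0 < min (ε / 2) (η / 2) := by positivity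
  have hUo : ∀ x, IsOpen (U x) := fun x => (hV x).2.inter Metric.isOpen_ball
  have hxU : ∀ x, x ∈ U x := fun x => ⟨(hV x).1, Metric.mem_ball_self hr⟩
  have hg : ∀ x, ∃ y, y ∈ U x ∧ y ≠ x := by
    intro x
    have := hX x
    obtain ⟨y, hy1, hy2⟩ := Filter.nonempty_of_mem
      (Filter.inter_mem (mem_nhdsWithin_of_mem_nhds ((hUo x).mem_nhds (hxU x)))
        (self_mem_nhdsWithin (a := x) (s := {x}ᶜ)))
    exact ⟨y, hy1, hy2⟩
  choose g hgU hgne using hg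
  let K : NonemptyCompacts X := ⟨⟨(F : Set X) ∪ g '' F, (hF.union (hF.image g)).isCompact⟩,
    F.nonempty.mono Set.subset_union_left⟩
  have hK : (K : Set X) = (F : Set X) ∪ g '' F := rfl
  refine ⟨K, hb ?_, ?_⟩
  · rw [Metric.mem_ball, Metric.NonemptyCompacts.dist_eq]
    refine lt_of_le_of_lt (Metric.hausdorffDist_le_of_mem_dist (r := η / 2) (by positivity) ?_ ?_)
      (by linarith)
    · rw [hK]
      rintro x (hx | ⟨y, hy, rfl⟩)
      · exact ⟨x, hx, by rw [dist_self]; positivity⟩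
      · exact ⟨y, hy, (Metric.mem_ball.1 (hgU y).2).le.trans (min_le_right _ _)⟩
    · intro x hx
      exact ⟨x, Or.inl hx, by rw [dist_self]; positivity⟩
  · let e := hF.toFinset.equivFin.symm
    have heF : ∀ i, (e i : X) ∈ (F : Set X) := fun i => hF.mem_toFinset.1 (e i).2
    refine ⟨_, fun i => U (e i), fun i => hUo _, ?_, ?_, ?_, ?_⟩
    · intro i j hij
      have : (e i : X) ≠ e j := fun h => hij (e.injective (Subtype.ext h))
      exact (hVd (heF i) (heF j) this).mono Set.inter_subset_left Set.inter_subset_left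
    · intro i x hx y hy
      have h1 := Metric.mem_ball.1 hx.2
      have h2 := Metric.mem_ball.1 hy.2
      have h3 := min_le_left (ε / 2) (η / 2)
      have := dist_triangle_right x y (e i : X)
      linarith
    · rw [hK]
      have key : ∀ x ∈ (F : Set X), U x ⊆ ⋃ i, U (e i) := by
        intro x hx y hy
        refine Set.mem_iUnion.2 ⟨e.symm ⟨x, hF.mem_toFinset.2 hx⟩, ?_⟩
        simpa using hy
      rintro x (hx | ⟨y, hy, rfl⟩)
      · exact key x hx (hxU x)
      · exact key y hy (hgU y)
    · intro i
      exact ⟨e i, ⟨Or.inl (heF i), hxU _⟩, g (e i), ⟨Or.inr ⟨_, heF i, rfl⟩, hgU _⟩,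
        (hgne _).symm⟩

lemma mem_cantorApprox {X : Type*} [MetricSpace X] {K : NonemptyCompacts X}
    (hp : Perfect (K : Set X)) (ht : IsTotallyDisconnected (K : Set X)) {ε : ℝ} (hε : 0 < ε) :
    K ∈ cantorApprox X ε := by
  have : TotallyDisconnectedSpace (K : Set X) := totallyDisconnectedSpace_subtype_iff.2 ht
  have : CompactSpace (K : Set X) := isCompact_iff_compactSpace.1 K.isCompact
  let f : C((K : Set X), X) := ⟨Subtype.val, continuous_subtype_val⟩
  have hS : {p : X × X | dist p.1 p.2 < ε / 3} ∈ nhdsSet (Set.diagonal X) := by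
    refine (isOpen_lt continuous_dist continuous_const).mem_nhdsSet.2 ?_
    rintro ⟨x, y⟩ (rfl : x = y)
    simp; positivity
  obtain ⟨n, D, hDne, hDS, hDc, hDd⟩ :=
    f.exists_disjoint_nonempty_clopen_cover_of_mem_nhds_diagonal hS
  let C : Fin n → Set X := fun i => Subtype.val '' (D i : Set (K : Set X))
  have hCK : ∀ i, C i ⊆ K := by
    rintro i _ ⟨x, -, rfl⟩; exact x.2
  have hCd : ∀ i j, i ≠ j → Disjoint (C i) (C j) := by
    intro i j hij
    refine (Set.disjoint_image_iff Subtype.val_injective).2 ?_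
    have := hDd hij
    rw [Function.onFun, disjoint_iff] at this
    rw [Set.disjoint_iff_inter_eq_empty, ← Clopens.coe_inf, this]; rfl
  have hcl : ∀ i, IsClosed ((K : Set X) \ C i) := by
    intro i
    have : (K : Set X) \ C i = Subtype.val '' ((D i : Set (K : Set X))ᶜ) := by
      rw [Set.image_compl_eq_range_diff_image Subtype.val_injective, Subtype.range_coe]
    rw [this]
    exact ((D i).isClopen.compl.isClosed.isCompact.image continuous_subtype_val).isClosed
  let U : Fin n → Set X := fun i =>
    {x | Metric.infEDist x (C i) < Metric.infEDist x ((K : Set X) \ C i)} ∩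
      Metric.thickening (ε / 3) (C i)
  have hUo : ∀ i, IsOpen (U i) := fun i =>
    (isOpen_lt Metric.continuous_infEDist Metric.continuous_infEDist).inter
      Metric.isOpen_thickening
  have hCU : ∀ i, C i ⊆ U i := by
    intro i x hx
    refine ⟨?_, Metric.self_subset_thickening (by positivity) _ hx⟩
    show Metric.infEDist x (C i) < _
    rw [Metric.infEDist_zero_of_mem hx, pos_iff_ne_zero]
    intro h
    exact ((Metric.mem_iff_infEDist_zero_of_closed (hcl i)).2 h).2 hx
  have hne : ∀ i, (C i).Nonempty := by
    intro i
    rw [Set.image_nonempty, Set.nonempty_iff_ne_empty]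
    intro h
    exact hDne i (SetLike.coe_injective h)
  refine ⟨n, U, hUo, ?_, ?_, ?_, ?_⟩
  · intro i j hij
    rw [Set.disjoint_left]
    rintro x ⟨h1, -⟩ ⟨h2, -⟩
    have h3 : Metric.infEDist x ((K : Set X) \ C i) ≤ Metric.infEDist x (C j) :=
      Metric.infEDist_anti fun y hy => ⟨hCK j hy, fun h => (hCd i j hij).ne_of_mem h hy rfl⟩
    have h4 : Metric.infEDist x ((K : Set X) \ C j) ≤ Metric.infEDist x (C i) :=
      Metric.infEDist_anti fun y hy => ⟨hCK i hy, fun h => (hCd i j hij).ne_of_mem hy h rfl⟩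
    exact lt_irrefl _ (((lt_of_lt_of_le h1 h3).trans h2).trans_le h4)
  · rintro i x ⟨-, hx⟩ y ⟨-, hy⟩
    obtain ⟨_, ⟨a, ha, rfl⟩, hxa⟩ := Metric.mem_thickening_iff.1 hx
    obtain ⟨_, ⟨b, hb, rfl⟩, hyb⟩ := Metric.mem_thickening_iff.1 hy
    have hab : dist (a : X) (b : X) < ε / 3 := hDS i a ha b hb
    have := dist_triangle4_right x y (a : X) (b : X)
    linarith
  · intro x hx
    obtain ⟨i, hi⟩ := Set.mem_iUnion.1 (hDc (Set.mem_univ (⟨x, hx⟩ : (K : Set X))))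
    exact Set.mem_iUnion.2 ⟨i, hCU i ⟨_, hi, rfl⟩⟩
  · intro i
    obtain ⟨x, hx⟩ := hne i
    obtain ⟨y, ⟨hyU, hyK⟩, hyx⟩ := preperfect_iff_nhds.1 hp.acc x (hCK i hx) (U i)
      ((hUo i).mem_nhds (hCU i hx))
    exact ⟨x, ⟨hCK i hx, hCU i hx⟩, y, ⟨hyK, hyU⟩, hyx.symm⟩

lemma perfect_of_cantorApprox {X : Type*} [MetricSpace X] {K : NonemptyCompacts X}
    (h : ∀ ε > 0, K ∈ cantorApprox X ε) :
    Perfect (K : Set X) ∧ IsTotallyDisconnected (K : Set X) := by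
  refine ⟨⟨K.isCompact.isClosed, preperfect_iff_nhds.2 ?_⟩, ?_⟩
  · intro x hx V hV
    obtain ⟨ε, hε, hb⟩ := Metric.mem_nhds_iff.1 hV
    obtain ⟨n, U, hU, hd, hdist, hK, hn⟩ := h ε hε
    obtain ⟨i, hi⟩ := Set.mem_iUnion.1 (hK hx)
    obtain ⟨y, ⟨hyK, hyU⟩, hyx⟩ := (hn i).exists_ne x
    exact ⟨y, ⟨hb (hdist i y hyU x hi), hyK⟩, hyx⟩
  · intro t htK ht x hx y hy
    by_contra hxy
    obtain ⟨n, U, hU, hd, hdist, hK, hn⟩ := h (dist x y) (dist_pos.2 hxy)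
    obtain ⟨i, hi⟩ := Set.mem_iUnion.1 (hK (htK hx))
    obtain ⟨j, hj⟩ := Set.mem_iUnion.1 (hK (htK hy))
    have hij : j ≠ i := by
      rintro rfl
      exact lt_irrefl _ (hdist j x hi y hj)
    obtain ⟨z, -, hz1, hz2⟩ := ht (U i) (⋃ k ∈ {k | k ≠ i}, U k) (hU i)
      (isOpen_biUnion fun k _ => hU k) (by
        intro z hz
        obtain ⟨k, hk⟩ := Set.mem_iUnion.1 (hK (htK hz))
        by_cases hki : k = i
        · subst hki; exact Or.inl hk
        · exact Or.inr (Set.mem_biUnion (show k ∈ {k | k ≠ i} from hki) hk)) ⟨x, hx, hi⟩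
      ⟨y, hy, Set.mem_biUnion (show j ∈ {k | k ≠ i} from hij) hj⟩
    obtain ⟨k, hk, hzk⟩ := Set.mem_iUnion₂.1 hz2
    exact (hd k i hk).ne_of_mem hzk hz1 rfl

lemma cantorApprox_mono {X : Type*} [MetricSpace X] {a b : ℝ} (hab : a ≤ b) :
    cantorApprox X a ⊆ cantorApprox X b := by
  rintro K ⟨n, U, hU, hd, hdist, h⟩
  exact ⟨n, U, hU, hd, fun i x hx y hy => (hdist i x hx y hy).trans_le hab, h⟩

theorem stmt5 (X : Type*) [MetricSpace X] [CompleteSpace X]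
    (hX : ∀ x : X, Filter.NeBot (nhdsWithin x {x}ᶜ)) :
    Dense {K : NonemptyCompacts X | Perfect (K : Set X) ∧ IsTotallyDisconnected (K : Set X)} ∧
    IsGδ {K : NonemptyCompacts X | Perfect (K : Set X) ∧ IsTotallyDisconnected (K : Set X)} := by
  have key : {K : NonemptyCompacts X | Perfect (K : Set X) ∧ IsTotallyDisconnected (K : Set X)} =
      ⋂ n : ℕ, cantorApprox X (1 / ((n : ℝ) + 1)) := by
    ext K
    rw [Set.mem_iInter]
    constructor
    · rintro ⟨h1, h2⟩ n
      exact mem_cantorApprox h1 h2 (by positivity)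
    · intro h
      refine perfect_of_cantorApprox fun ε hε => ?_
      obtain ⟨n, hn⟩ := exists_nat_one_div_lt hε
      exact cantorApprox_mono hn.le (h n)
  rw [key]
  exact ⟨dense_iInter_of_isOpen_nat (fun n => isOpen_cantorApprox X _)
      (fun n => dense_cantorApprox X hX (by positivity)),
    IsGδ.iInter_of_isOpen fun n => isOpen_cantorApprox X _⟩
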